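/- Let J : ℝ^{n_z} × ℝ^{n_p} → ℝ, G : ℝ^{n_z} × ℝ^{n_p} → ℝ^{n_G}, and H : ℝ^{n_z} × ℝ^{n_p} → ℝ^{n_H} be twice continuously differentiable, and let p̂ ∈ ℝ^{n_p} be a fixed nominal parameter. Suppose ẑ is a strongly regular local minimum of NLP(p̂) with associated Lagrange multipliers μ̂ ∈ ℝ^{n_G} and λ̂ ∈ ℝ^{n_H}. Then there exist ε > 0 and δ > 0 such that for each p in the ball B_ε(p̂) the problem NLP(p) possesses a strongly regular local minimum z*(p) with multipliers μ*(p), λ*(p) such that (z*(p), μ*(p), λ*(p)) is the unique such triple in the ball B_δ(ẑ, μ̂, λ̂), (z*(p̂), μ*(p̂), λ*(p̂)) = (ẑ, μ̂, λ̂), and the active index set is invariant: A(z*(p), p) = A(ẑ, p̂) for all p ∈ B_ε(p̂). -/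

import Mathlib

open Metric

/-- The Lagrange function `L(z, μ, λ, p) = J(z,p) + μᵀG(z,p) + λᵀH(z,p)`
of the parametric nonlinear program NLP(p):
minimize `J(z,p)` subject to `H(z,p) = 0` and `G(z,p) ≤ 0`. -/
noncomputable def Lagrangian {nz np nG nH : ℕ}
    (J : (Fin nz → ℝ) → (Fin np → ℝ) → ℝ)
    (G : (Fin nz → ℝ) → (Fin np → ℝ) → Fin nG → ℝ)
    (H : (Fin nz → ℝ) → (Fin np → ℝ) → Fin nH → ℝ)
    (z : Fin nz → ℝ) (μ : Fin nG → ℝ) (lam : Fin nH → ℝ) (p : Fin np → ℝ) : ℝ :=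
  J z p + ∑ i, μ i * G z p i + ∑ j, lam j * H z p j

/-- `zhat` is a strongly regular local minimum of NLP(phat) with Lagrange multipliers `muhat, λ̂`:
`zhat` is a feasible local minimum and (a) LICQ, (b) the KKT conditions,
(c) strict complementarity, and (d) the second-order sufficient condition hold. -/
noncomputable def StronglyRegular {nz np nG nH : ℕ}
    (J : (Fin nz → ℝ) → (Fin np → ℝ) → ℝ)
    (G : (Fin nz → ℝ) → (Fin np → ℝ) → Fin nG → ℝ)
    (H : (Fin nz → ℝ) → (Fin np → ℝ) → Fin nH → ℝ)
    (phat : Fin np → ℝ) (zhat : Fin nz → ℝ) (muhat : Fin nG → ℝ) (lamhat : Fin nH → ℝ) : Prop :=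
  -- `zhat` is feasible for NLP(phat)
  ((∀ j, H zhat phat j = 0) ∧ (∀ i, G zhat phat i ≤ 0)) ∧
  -- `zhat` is a local minimum of NLP(phat)
  IsLocalMinOn (fun z => J z phat)
    {z | (∀ j, H z phat j = 0) ∧ (∀ i, G z phat i ≤ 0)} zhat ∧
  -- (a) LICQ: gradients of active inequality constraints and equality constraints
  -- are linearly independent
  LinearIndependent ℝ
    (Sum.elim
      (fun i : {i : Fin nG // G zhat phat i = 0} => fderiv ℝ (fun z => G z phat i.1) zhat)
      (fun j : Fin nH => fderiv ℝ (fun z => H z phat j) zhat)) ∧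
  -- (b) KKT conditions
  (fderiv ℝ (fun z => Lagrangian J G H z muhat lamhat phat) zhat = 0 ∧
    (∀ i, 0 ≤ muhat i) ∧ ∑ i, muhat i * G zhat phat i = 0) ∧
  -- (c) strict complementarity
  (∀ i, 0 < muhat i - G zhat phat i) ∧
  -- (d) second-order condition on the critical subspace
  (∀ d : Fin nz → ℝ, d ≠ 0 →
    (∀ i, G zhat phat i = 0 → fderiv ℝ (fun z => G z phat i) zhat d = 0) →
    (∀ j, fderiv ℝ (fun z => H z phat j) zhat d = 0) →
    0 < fderiv ℝ (fun z => fderiv ℝ (fun w => Lagrangian J G H w muhat lamhat phat) z) zhat d d)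

open Filter Topology

/-- A function whose derivative at `z` is positive in the direction `d` increases along all
short segments from `z` with direction close to `d`. -/
lemma eventually_lt_add_smul_of_fderiv_pos {E : Type*} [NormedAddCommGroup E] [NormedSpace ℝ E]
    {f : E → ℝ} {f' : E →L[ℝ] ℝ} {z d : E} (hf : HasFDerivAt f f' z) (hd : 0 < f' d) :
    ∀ᶠ q : ℝ × E in 𝓝 (0, d), 0 < q.1 → f z < f (z + q.1 • q.2) := by
  have hc : 0 < f' d / (2 * (‖d‖ + 1)) := by positivity
  have hv : Tendsto (fun q : ℝ × E => z + q.1 • q.2) (𝓝 (0, d)) (𝓝 z) := by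
    have : ContinuousAt (fun q : ℝ × E => z + q.1 • q.2) (0, d) := by fun_prop
    simpa [ContinuousAt] using this
  have h1 := hv.eventually (hf.isLittleO.def hc)
  have h2 : ∀ᶠ q : ℝ × E in 𝓝 (0, d), f' d / 2 < f' q.2 :=
    (show ContinuousAt (fun q : ℝ × E => f' q.2) (0, d) by fun_prop).eventually_const_lt
      (by linarith : f' d / 2 < f' d)
  have h3 : ∀ᶠ q : ℝ × E in 𝓝 (0, d), ‖q.2‖ < ‖d‖ + 1 :=
    (show ContinuousAt (fun q : ℝ × E => ‖q.2‖) (0, d) by fun_prop).eventually_lt_const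
      (by linarith : ‖d‖ < ‖d‖ + 1)
  filter_upwards [h1, h2, h3] with q h1 h2 h3 hq
  simp only [add_sub_cancel_left, map_smul, smul_eq_mul, norm_smul, Real.norm_eq_abs,
    abs_of_pos hq] at h1
  have h4 := (abs_le.1 h1).1
  have h5 : f' d / (2 * (‖d‖ + 1)) * (q.1 * ‖q.2‖) ≤ q.1 * (f' d / 2) := by
    calc f' d / (2 * (‖d‖ + 1)) * (q.1 * ‖q.2‖)
        ≤ f' d / (2 * (‖d‖ + 1)) * (q.1 * (‖d‖ + 1)) := by gcongr
      _ = q.1 * (f' d / 2) := by field_simp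
  have h6 := mul_lt_mul_of_pos_left h2 hq
  linarith

/-- At a critical point `z`, a function whose second derivative is positive in the direction `d`
increases along all short segments from `z` with direction close to `d`. -/
lemma eventually_lt_add_smul_of_fderiv_fderiv_pos {E : Type*} [NormedAddCommGroup E]
    [NormedSpace ℝ E] {f : E → ℝ} {B : E →L[ℝ] E →L[ℝ] ℝ} {z d : E} (hf : Differentiable ℝ f)
    (hB : HasFDerivAt (fderiv ℝ f) B z) (hz : fderiv ℝ f z = 0) (hd : 0 < B d d) :
    ∀ᶠ q : ℝ × E in 𝓝 (0, d), 0 < q.1 → f z < f (z + q.1 • q.2) := by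
  have hc : 0 < B d d / (2 * (‖d‖ + 1) ^ 2) := by positivity
  have hv : Tendsto (fun q : ℝ × E => z + q.1 • q.2) (𝓝 (0, d)) (𝓝 z) := by
    have : ContinuousAt (fun q : ℝ × E => z + q.1 • q.2) (0, d) := by fun_prop
    simpa [ContinuousAt] using this
  have h1 := hv.eventually (hB.isLittleO.def hc)
  have h2 : ∀ᶠ q : ℝ × E in 𝓝 (0, d), B d d / 2 < B q.2 q.2 :=
    (show ContinuousAt (fun q : ℝ × E => B q.2 q.2) (0, d) by fun_prop).eventually_const_lt
      (by linarith : B d d / 2 < B d d)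
  have h3 : ∀ᶠ q : ℝ × E in 𝓝 (0, d), ‖q.2‖ < ‖d‖ + 1 :=
    (show ContinuousAt (fun q : ℝ × E => ‖q.2‖) (0, d) by fun_prop).eventually_lt_const
      (by linarith : ‖d‖ < ‖d‖ + 1)
  have h : ∀ᶠ q : ℝ × E in 𝓝 (0, d), 0 < q.1 → 0 < fderiv ℝ f (z + q.1 • q.2) q.2 := by
    filter_upwards [h1, h2, h3] with q h1 h2 h3 hq
    simp only [add_sub_cancel_left, hz, sub_zero, map_smul, norm_smul, Real.norm_eq_abs,
      abs_of_pos hq] at h1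
    have h4 := (ContinuousLinearMap.le_opNorm (fderiv ℝ f (z + q.1 • q.2) - q.1 • B q.2) q.2).trans
      (mul_le_mul_of_nonneg_right h1 (norm_nonneg _))
    simp only [_root_.sub_apply, _root_.smul_apply, smul_eq_mul,
      Real.norm_eq_abs] at h4
    have h4 := (abs_le.1 h4).1
    have h5 : B d d / (2 * (‖d‖ + 1) ^ 2) * (q.1 * ‖q.2‖) * ‖q.2‖ ≤ q.1 * (B d d / 2) := by
      calc B d d / (2 * (‖d‖ + 1) ^ 2) * (q.1 * ‖q.2‖) * ‖q.2‖
          ≤ B d d / (2 * (‖d‖ + 1) ^ 2) * (q.1 * (‖d‖ + 1)) * (‖d‖ + 1) := by gcongr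
        _ = q.1 * (B d d / 2) := by field_simp
    have h6 := mul_lt_mul_of_pos_left h2 hq
    linarith
  obtain ⟨r, hr, h⟩ := Metric.eventually_nhds_iff.1 h
  refine Metric.eventually_nhds_iff.2 ⟨r, hr, fun q hq hq0 => ?_⟩
  obtain ⟨t, v⟩ := q
  simp only [Prod.dist_eq, max_lt_iff, dist_zero_right, Real.norm_eq_abs] at hq hq0 h
  have hder : ∀ s : ℝ, HasDerivAt (fun s : ℝ => f (z + s • v)) (fderiv ℝ f (z + s • v) v) s := by
    intro s
    have := ((hasDerivAt_id s).smul_const v).const_add z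
    simp only [one_smul] at this
    exact (hf _).hasFDerivAt.comp_hasDerivAt s this
  have hmono : StrictMonoOn (fun s : ℝ => f (z + s • v)) (Set.Icc 0 t) := by
    refine strictMonoOn_of_deriv_pos (convex_Icc 0 t)
      (fun s _ => (hder s).continuousAt.continuousWithinAt) fun s hs => ?_
    rw [interior_Icc] at hs
    rw [(hder s).deriv]
    refine h (y := (s, v)) ⟨?_, hq.2⟩ hs.1
    rw [abs_of_pos hs.1]
    exact hs.2.trans ((le_abs_self t).trans_lt hq.1)
  simpa using hmono (Set.left_mem_Icc.2 hq0.le) (Set.right_mem_Icc.2 hq0.le) hq0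

/-- Second-order sufficient condition for a constrained local minimum, under strict
complementarity. -/
lemma isLocalMinOn_of_second_order {E ι κ : Type*} [NormedAddCommGroup E] [NormedSpace ℝ E]
    [ProperSpace E] [Fintype ι] [Fintype κ] {f : E → ℝ} {g : ι → E → ℝ} {h : κ → E → ℝ}
    {z : E} {μ : ι → ℝ} {lam : κ → ℝ} {B : E →L[ℝ] E →L[ℝ] ℝ}
    (hf : Differentiable ℝ f) (hg : ∀ i, Differentiable ℝ (g i))
    (hh : ∀ j, Differentiable ℝ (h j))
    (hgz : ∀ i, g i z < 0 → μ i = 0) (hgz' : ∀ i, g i z ≤ 0) (hhz : ∀ j, h j z = 0)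
    (hμ : ∀ i, g i z = 0 → 0 < μ i)
    (hB : HasFDerivAt (fderiv ℝ fun w => f w + ∑ i, μ i * g i w + ∑ j, lam j * h j w) B z)
    (hz : fderiv ℝ (fun w => f w + ∑ i, μ i * g i w + ∑ j, lam j * h j w) z = 0)
    (hpos : ∀ d : E, d ≠ 0 → (∀ i, g i z = 0 → fderiv ℝ (g i) z d = 0) →
      (∀ j, fderiv ℝ (h j) z d = 0) → 0 < B d d) :
    IsLocalMinOn f {w | (∀ j, h j w = 0) ∧ ∀ i, g i w ≤ 0} z := by
  have hL : Differentiable ℝ fun w => f w + ∑ i, μ i * g i w + ∑ j, lam j * h j w := by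
    fun_prop
  have hLz : ∀ d, fderiv ℝ f z d + ∑ i, μ i * fderiv ℝ (g i) z d
      + ∑ j, lam j * fderiv ℝ (h j) z d = 0 := by
    intro d
    have h1 : HasFDerivAt (fun w => f w + ∑ i, μ i * g i w + ∑ j, lam j * h j w)
        (fderiv ℝ f z + ∑ i, μ i • fderiv ℝ (g i) z + ∑ j, lam j • fderiv ℝ (h j) z) z :=
      ((hf z).hasFDerivAt.add (HasFDerivAt.fun_sum fun i _ =>
        ((hg i z).hasFDerivAt.const_mul (μ i)))).add
        (HasFDerivAt.fun_sum fun j _ => ((hh j z).hasFDerivAt.const_mul (lam j)))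
    have h2 := DFunLike.congr_fun (h1.fderiv.symm.trans hz) d
    simpa [_root_.sum_apply] using h2
  have hμ0 : ∀ i, 0 ≤ μ i := fun i => by
    rcases (hgz' i).lt_or_eq with h | h
    · exact (hgz i h).ge
    · exact (hμ i h).le
  have key : ∀ᶠ t : ℝ in 𝓝 0, ∀ d ∈ Metric.sphere (0 : E) 1, 0 < t →
      (∀ j, h j (z + t • d) = 0) → (∀ i, g i (z + t • d) ≤ 0) → f z ≤ f (z + t • d) := by
    refine (isCompact_sphere (0 : E) 1).eventually_forall_of_forall_eventually fun d hd => ?_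
    have hd0 : d ≠ 0 := by
      rintro rfl
      simp at hd
    by_cases h1 : ∃ j, fderiv ℝ (h j) z d ≠ 0
    · obtain ⟨j, hj⟩ := h1
      rcases hj.lt_or_gt with hj | hj
      · have := eventually_lt_add_smul_of_fderiv_pos (d := d) (hh j z).hasFDerivAt.neg
          (by simpa using hj)
        filter_upwards [this] with q hq h0 hq' _
        have := hq h0
        simp [hq' j, hhz j] at this
      · filter_upwards [eventually_lt_add_smul_of_fderiv_pos (hh j z).hasFDerivAt hj]
          with q hq h0 hq' _
        have := hq h0
        simp [hq' j, hhz j] at this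
    push Not at h1
    by_cases h2 : ∃ i, g i z = 0 ∧ 0 < fderiv ℝ (g i) z d
    · obtain ⟨i, hi, hi'⟩ := h2
      filter_upwards [eventually_lt_add_smul_of_fderiv_pos (hg i z).hasFDerivAt hi']
        with q hq h0 _ hq'
      have := hq h0
      have := hq' i
      linarith
    push Not at h2
    have hterm : ∀ i, μ i * fderiv ℝ (g i) z d ≤ 0 := fun i => by
      rcases (hgz' i).lt_or_eq with h | h
      · simp [hgz i h]
      · exact mul_nonpos_of_nonneg_of_nonpos (hμ0 i) (h2 i h)
    by_cases h3 : ∃ i, g i z = 0 ∧ fderiv ℝ (g i) z d < 0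
    · obtain ⟨i, hi, hi'⟩ := h3
      have hsum : ∑ i, μ i * fderiv ℝ (g i) z d < 0 :=
        Finset.sum_neg' (fun i _ => hterm i) ⟨i, Finset.mem_univ i, by
          exact mul_neg_of_pos_of_neg (hμ i hi) hi'⟩
      have hfd : 0 < fderiv ℝ f z d := by
        have := hLz d
        simp only [h1, mul_zero, Finset.sum_const_zero, add_zero] at this
        linarith
      filter_upwards [eventually_lt_add_smul_of_fderiv_pos (hf z).hasFDerivAt hfd]
        with q hq h0 _ _ using (hq h0).le
    push Not at h3
    have hBd := hpos d hd0 (fun i hi => le_antisymm (h2 i hi) (h3 i hi)) h1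
    filter_upwards [eventually_lt_add_smul_of_fderiv_fderiv_pos hL hB hz hBd] with q hq h0 hqh hqg
    have h4 := hq h0
    have h5 : ∑ i, μ i * g i z = 0 := Finset.sum_eq_zero fun i _ => by
      rcases (hgz' i).lt_or_eq with h | h
      · simp [hgz i h]
      · simp [h]
    have h6 : ∑ i, μ i * g i (z + q.1 • q.2) ≤ 0 :=
      Finset.sum_nonpos fun i _ => mul_nonpos_of_nonneg_of_nonpos (hμ0 i) (hqg i)
    simp only [hqh, hhz, mul_zero, Finset.sum_const_zero, add_zero, h5] at h4
    linarith
  have hn : Tendsto (fun w => ‖w - z‖) (𝓝 z) (𝓝 0) := by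
    have : Continuous fun w : E => ‖w - z‖ := by fun_prop
    simpa using this.tendsto z
  refine eventually_nhdsWithin_iff.2 ?_
  filter_upwards [hn.eventually key] with w hw hwS
  rcases eq_or_ne w z with rfl | hne
  · exact le_rfl
  have hpos' : 0 < ‖w - z‖ := norm_pos_iff.2 (sub_ne_zero.2 hne)
  have heq : z + ‖w - z‖ • (‖w - z‖⁻¹ • (w - z)) = w := by
    rw [smul_inv_smul₀ hpos'.ne', add_sub_cancel]
  have := hw (‖w - z‖⁻¹ • (w - z)) (by simp [norm_smul, hpos'.ne']) hpos'
  rw [heq] at this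
  exact this hwS.1 hwS.2

section KKT

variable {nz np nG nH : ℕ}
    {J : (Fin nz → ℝ) → (Fin np → ℝ) → ℝ}
    {G : (Fin nz → ℝ) → (Fin np → ℝ) → Fin nG → ℝ}
    {H : (Fin nz → ℝ) → (Fin np → ℝ) → Fin nH → ℝ}

/-- The gradient in `z` of the Lagrange function, as a function of `(p, (z, μ, λ))`. -/
noncomputable def lagrangianGrad (J : (Fin nz → ℝ) → (Fin np → ℝ) → ℝ)
    (G : (Fin nz → ℝ) → (Fin np → ℝ) → Fin nG → ℝ)
    (H : (Fin nz → ℝ) → (Fin np → ℝ) → Fin nH → ℝ)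
    (q : (Fin np → ℝ) × ((Fin nz → ℝ) × (Fin nG → ℝ) × (Fin nH → ℝ))) :
    (Fin nz → ℝ) →L[ℝ] ℝ :=
  fderiv ℝ (fun w => Lagrangian J G H w q.2.2.1 q.2.2.2 q.1) q.2.1

/-- The Hessian in `z` of the Lagrange function, as a function of `(p, (z, μ, λ))`. -/
noncomputable def lagrangianHess (J : (Fin nz → ℝ) → (Fin np → ℝ) → ℝ)
    (G : (Fin nz → ℝ) → (Fin np → ℝ) → Fin nG → ℝ)
    (H : (Fin nz → ℝ) → (Fin np → ℝ) → Fin nH → ℝ)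
    (q : (Fin np → ℝ) × ((Fin nz → ℝ) × (Fin nG → ℝ) × (Fin nH → ℝ))) :
    (Fin nz → ℝ) →L[ℝ] (Fin nz → ℝ) →L[ℝ] ℝ :=
  fderiv ℝ (fun z => fderiv ℝ (fun w => Lagrangian J G H w q.2.2.1 q.2.2.2 q.1) z) q.2.1

lemma contDiff_lagrangian
    (hJ : ContDiff ℝ 2 fun q : (Fin nz → ℝ) × (Fin np → ℝ) => J q.1 q.2)
    (hG : ContDiff ℝ 2 fun q : (Fin nz → ℝ) × (Fin np → ℝ) => G q.1 q.2)
    (hH : ContDiff ℝ 2 fun q : (Fin nz → ℝ) × (Fin np → ℝ) => H q.1 q.2) :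
    ContDiff ℝ 2 (Function.uncurry
      fun (q : (Fin np → ℝ) × ((Fin nz → ℝ) × (Fin nG → ℝ) × (Fin nH → ℝ))) (w : Fin nz → ℝ) =>
        Lagrangian J G H w q.2.2.1 q.2.2.2 q.1) := by
  rw [contDiff_pi] at hG hH
  have hJ' := hJ.comp (g := fun q : (Fin nz → ℝ) × (Fin np → ℝ) => J q.1 q.2)
    (f := fun q : ((Fin np → ℝ) × ((Fin nz → ℝ) × (Fin nG → ℝ) × (Fin nH → ℝ))) × (Fin nz → ℝ) =>
      (q.2, q.1.1)) (by fun_prop)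
  have hG' := fun i => (hG i).comp
    (f := fun q : ((Fin np → ℝ) × ((Fin nz → ℝ) × (Fin nG → ℝ) × (Fin nH → ℝ))) × (Fin nz → ℝ) =>
      (q.2, q.1.1)) (by fun_prop)
  have hH' := fun i => (hH i).comp
    (f := fun q : ((Fin np → ℝ) × ((Fin nz → ℝ) × (Fin nG → ℝ) × (Fin nH → ℝ))) × (Fin nz → ℝ) =>
      (q.2, q.1.1)) (by fun_prop)
  simp only [Function.comp_def] at hJ' hG' hH'
  simp only [Function.uncurry_def, Lagrangian]
  fun_prop

lemma contDiff_lagrangianGrad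
    (hJ : ContDiff ℝ 2 fun q : (Fin nz → ℝ) × (Fin np → ℝ) => J q.1 q.2)
    (hG : ContDiff ℝ 2 fun q : (Fin nz → ℝ) × (Fin np → ℝ) => G q.1 q.2)
    (hH : ContDiff ℝ 2 fun q : (Fin nz → ℝ) × (Fin np → ℝ) => H q.1 q.2) :
    ContDiff ℝ 1 (lagrangianGrad J G H) :=
  (contDiff_lagrangian hJ hG hH).fderiv (g := fun q => q.2.1) (by fun_prop) (by norm_num)

lemma continuous_lagrangianHess
    (hJ : ContDiff ℝ 2 fun q : (Fin nz → ℝ) × (Fin np → ℝ) => J q.1 q.2)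
    (hG : ContDiff ℝ 2 fun q : (Fin nz → ℝ) × (Fin np → ℝ) => G q.1 q.2)
    (hH : ContDiff ℝ 2 fun q : (Fin nz → ℝ) × (Fin np → ℝ) => H q.1 q.2) :
    Continuous (lagrangianHess J G H) := by
  have h1 : ContDiff ℝ 1 (Function.uncurry
      fun (q : (Fin np → ℝ) × ((Fin nz → ℝ) × (Fin nG → ℝ) × (Fin nH → ℝ))) (z : Fin nz → ℝ) =>
        fderiv ℝ (fun w => Lagrangian J G H w q.2.2.1 q.2.2.2 q.1) z) :=
    (contDiff_lagrangianGrad hJ hG hH).comp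
      (f := fun r : ((Fin np → ℝ) × ((Fin nz → ℝ) × (Fin nG → ℝ) × (Fin nH → ℝ))) × (Fin nz → ℝ) =>
        (r.1.1, (r.2, r.1.2.2))) (by fun_prop)
  exact (h1.fderiv (n := 0) (g := fun q => q.2.1) (by fun_prop) (by norm_num)).continuous

lemma hasFDerivAt_fderiv_lagrangian
    (hJ : ContDiff ℝ 2 fun q : (Fin nz → ℝ) × (Fin np → ℝ) => J q.1 q.2)
    (hG : ContDiff ℝ 2 fun q : (Fin nz → ℝ) × (Fin np → ℝ) => G q.1 q.2)
    (hH : ContDiff ℝ 2 fun q : (Fin nz → ℝ) × (Fin np → ℝ) => H q.1 q.2)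
    (p : Fin np → ℝ) (z : Fin nz → ℝ) (μ : Fin nG → ℝ) (lam : Fin nH → ℝ) :
    HasFDerivAt (fderiv ℝ fun w => Lagrangian J G H w μ lam p)
      (lagrangianHess J G H (p, (z, μ, lam))) z := by
  have h : ContDiff ℝ 1 fun z : Fin nz → ℝ => lagrangianGrad J G H (p, (z, μ, lam)) :=
    (contDiff_lagrangianGrad hJ hG hH).comp (f := fun z => (p, (z, μ, lam))) (by fun_prop)
  exact (h.differentiable one_ne_zero z).hasFDerivAt

/-- The partial map of a jointly `C²` function is `C²`. -/
lemma contDiff_curry_left {f : (Fin nz → ℝ) → (Fin np → ℝ) → ℝ}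
    (hf : ContDiff ℝ 2 fun q : (Fin nz → ℝ) × (Fin np → ℝ) => f q.1 q.2) (p : Fin np → ℝ) :
    ContDiff ℝ 2 fun z => f z p :=
  hf.comp (f := fun z => (z, p)) (by fun_prop)

lemma differentiable_curry_left {f : (Fin nz → ℝ) → (Fin np → ℝ) → ℝ}
    (hf : ContDiff ℝ 2 fun q : (Fin nz → ℝ) × (Fin np → ℝ) => f q.1 q.2) (p : Fin np → ℝ) :
    Differentiable ℝ fun z => f z p :=
  (contDiff_curry_left hf p).differentiable two_ne_zero

lemma continuous_fderiv_curry_left {f : (Fin nz → ℝ) → (Fin np → ℝ) → ℝ}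
    (hf : ContDiff ℝ 2 fun q : (Fin nz → ℝ) × (Fin np → ℝ) => f q.1 q.2) :
    Continuous fun q : (Fin np → ℝ) × ((Fin nz → ℝ) × (Fin nG → ℝ) × (Fin nH → ℝ)) =>
      fderiv ℝ (fun z => f z q.1) q.2.1 := by
  have h : ContDiff ℝ 2 (Function.uncurry
      fun (q : (Fin np → ℝ) × ((Fin nz → ℝ) × (Fin nG → ℝ) × (Fin nH → ℝ))) (z : Fin nz → ℝ) =>
        f z q.1) :=
    hf.comp (f := fun r : ((Fin np → ℝ) × ((Fin nz → ℝ) × (Fin nG → ℝ) × (Fin nH → ℝ))) ×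
      (Fin nz → ℝ) => (r.2, r.1.1)) (by fun_prop)
  exact (h.fderiv (n := 0) (g := fun q => q.2.1) (by fun_prop) (by norm_num)).continuous

lemma lagrangianGrad_eq
    (hJ : ContDiff ℝ 2 fun q : (Fin nz → ℝ) × (Fin np → ℝ) => J q.1 q.2)
    (hG : ContDiff ℝ 2 fun q : (Fin nz → ℝ) × (Fin np → ℝ) => G q.1 q.2)
    (hH : ContDiff ℝ 2 fun q : (Fin nz → ℝ) × (Fin np → ℝ) => H q.1 q.2)
    (p : Fin np → ℝ) (z : Fin nz → ℝ) (μ : Fin nG → ℝ) (lam : Fin nH → ℝ) :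
    lagrangianGrad J G H (p, (z, μ, lam)) = fderiv ℝ (fun w => J w p) z
      + ∑ i, μ i • fderiv ℝ (fun w => G w p i) z + ∑ j, lam j • fderiv ℝ (fun w => H w p j) z := by
  rw [contDiff_pi] at hG hH
  have hG' := fun i => differentiable_curry_left (f := fun z p => G z p i) (hG i) p z
  have hH' := fun j => differentiable_curry_left (f := fun z p => H z p j) (hH j) p z
  exact (((differentiable_curry_left hJ p z).hasFDerivAt.add (HasFDerivAt.fun_sum fun i _ =>
    (hG' i).hasFDerivAt.const_mul (μ i))).add
    (HasFDerivAt.fun_sum fun j _ => (hH' j).hasFDerivAt.const_mul (lam j))).fderiv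

open Classical in
/-- The KKT system with the inequality constraints in `A` treated as active, as a function of
`(p, (z, μ, λ))`. -/
noncomputable def kktMap (J : (Fin nz → ℝ) → (Fin np → ℝ) → ℝ)
    (G : (Fin nz → ℝ) → (Fin np → ℝ) → Fin nG → ℝ)
    (H : (Fin nz → ℝ) → (Fin np → ℝ) → Fin nH → ℝ) (A : Set (Fin nG))
    (q : (Fin np → ℝ) × ((Fin nz → ℝ) × (Fin nG → ℝ) × (Fin nH → ℝ))) :
    ((Fin nz → ℝ) →L[ℝ] ℝ) × (Fin nG → ℝ) × (Fin nH → ℝ) :=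
  (lagrangianGrad J G H q, fun i => if i ∈ A then G q.2.1 q.1 i else q.2.2.1 i, H q.2.1 q.1)

lemma contDiff_kktMap
    (hJ : ContDiff ℝ 2 fun q : (Fin nz → ℝ) × (Fin np → ℝ) => J q.1 q.2)
    (hG : ContDiff ℝ 2 fun q : (Fin nz → ℝ) × (Fin np → ℝ) => G q.1 q.2)
    (hH : ContDiff ℝ 2 fun q : (Fin nz → ℝ) × (Fin np → ℝ) => H q.1 q.2) (A : Set (Fin nG)) :
    ContDiff ℝ 1 (kktMap J G H A) := by
  have hG' := contDiff_pi.1 hG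
  have hs : ContDiff ℝ 2 fun q : (Fin np → ℝ) × ((Fin nz → ℝ) × (Fin nG → ℝ) × (Fin nH → ℝ)) =>
      (q.2.1, q.1) := by fun_prop
  refine (contDiff_lagrangianGrad hJ hG hH).prodMk (.prodMk (contDiff_pi.2 fun i => ?_)
    ((hH.comp hs).of_le one_le_two))
  by_cases hi : i ∈ A
  · simp only [hi, if_true]
    exact ((hG' i).comp hs).of_le one_le_two
  · simp only [hi, if_false]
    fun_prop

/-- The partial derivative of the gradient of the Lagrange function in `(z, μ, λ)`. -/
lemma fderiv_lagrangianGrad_apply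
    (hJ : ContDiff ℝ 2 fun q : (Fin nz → ℝ) × (Fin np → ℝ) => J q.1 q.2)
    (hG : ContDiff ℝ 2 fun q : (Fin nz → ℝ) × (Fin np → ℝ) => G q.1 q.2)
    (hH : ContDiff ℝ 2 fun q : (Fin nz → ℝ) × (Fin np → ℝ) => H q.1 q.2)
    (p : Fin np → ℝ) (z dz : Fin nz → ℝ) (μ dμ : Fin nG → ℝ) (lam dlam : Fin nH → ℝ) :
    fderiv ℝ (lagrangianGrad J G H) (p, (z, μ, lam)) (0, (dz, dμ, dlam)) =
      lagrangianHess J G H (p, (z, μ, lam)) dz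
      + (∑ i, dμ i • fderiv ℝ (fun w => G w p i) z
      + ∑ j, dlam j • fderiv ℝ (fun w => H w p j) z) := by
  set D := fderiv ℝ (lagrangianGrad J G H) (p, (z, μ, lam))
  have hdiff : HasFDerivAt (lagrangianGrad J G H) D (p, (z, μ, lam)) :=
    ((contDiff_lagrangianGrad hJ hG hH).differentiable one_ne_zero _).hasFDerivAt
  have h1 : D (0, (dz, 0, 0)) = lagrangianHess J G H (p, (z, μ, lam)) dz := by
    have hi : HasFDerivAt (fun w : Fin nz → ℝ => (p, (w, μ, lam)))
        ((0 : (Fin nz → ℝ) →L[ℝ] (Fin np → ℝ)).prod ((ContinuousLinearMap.id ℝ _).prod 0)) z :=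
      (hasFDerivAt_const p z).prodMk ((hasFDerivAt_id z).prodMk (hasFDerivAt_const (μ, lam) z))
    have h3 : HasFDerivAt (fun w => lagrangianGrad J G H (p, (w, μ, lam)))
        (lagrangianHess J G H (p, (z, μ, lam))) z :=
      hasFDerivAt_fderiv_lagrangian hJ hG hH p z μ lam
    have h4 : HasFDerivAt (fun w => lagrangianGrad J G H (p, (w, μ, lam))) _ z :=
      HasFDerivAt.comp z (g := lagrangianGrad J G H) hdiff hi
    rw [← h4.unique h3]
    rfl
  have h2 : D (0, (0, dμ, dlam)) = ∑ i, dμ i • fderiv ℝ (fun w => G w p i) z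
      + ∑ j, dlam j • fderiv ℝ (fun w => H w p j) z := by
    have hi : HasDerivAt (fun t : ℝ => (p, (z, μ + t • dμ, lam + t • dlam)))
        (0, (0, dμ, dlam)) 0 := by
      refine (hasDerivAt_const _ _).prodMk ((hasDerivAt_const _ _).prodMk (.prodMk ?_ ?_))
      · simpa using ((hasDerivAt_id (0 : ℝ)).smul_const dμ).const_add μ
      · simpa using ((hasDerivAt_id (0 : ℝ)).smul_const dlam).const_add lam
    have h3 := HasFDerivAt.comp_hasDerivAt (0 : ℝ) (l := lagrangianGrad J G H) (l' := D)
      (by simpa using hdiff) hi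
    refine h3.unique ?_
    have h4 : (lagrangianGrad J G H ∘ fun t : ℝ => (p, (z, μ + t • dμ, lam + t • dlam))) =
        fun t : ℝ => lagrangianGrad J G H (p, (z, μ, lam)) +
          t • (∑ i, dμ i • fderiv ℝ (fun w => G w p i) z
            + ∑ j, dlam j • fderiv ℝ (fun w => H w p j) z) := by
      funext t
      simp only [Function.comp_apply, lagrangianGrad_eq hJ hG hH, Pi.add_apply, Pi.smul_apply,
        add_smul, Finset.sum_add_distrib, smul_add, Finset.smul_sum, smul_smul, smul_eq_mul]
      abel
    rw [h4]
    simpa using ((hasDerivAt_id (0 : ℝ)).smul_const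
      (∑ i, dμ i • fderiv ℝ (fun w => G w p i) z
            + ∑ j, dlam j • fderiv ℝ (fun w => H w p j) z)).const_add
        (lagrangianGrad J G H (p, (z, μ, lam)))
  have h5 : ((0 : Fin np → ℝ), (dz, dμ, dlam)) = (0, (dz, 0, 0)) + (0, (0, dμ, dlam)) := by simp
  rw [h5, map_add, h1, h2]

/-- Under LICQ and the second-order condition, the KKT system has injective partial derivative
in `(z, μ, λ)`. -/
lemma injective_fderiv_kktMap
    (hJ : ContDiff ℝ 2 fun q : (Fin nz → ℝ) × (Fin np → ℝ) => J q.1 q.2)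
    (hG : ContDiff ℝ 2 fun q : (Fin nz → ℝ) × (Fin np → ℝ) => G q.1 q.2)
    (hH : ContDiff ℝ 2 fun q : (Fin nz → ℝ) × (Fin np → ℝ) => H q.1 q.2) (A : Set (Fin nG))
    {p : Fin np → ℝ} {z : Fin nz → ℝ} {μ : Fin nG → ℝ} {lam : Fin nH → ℝ}
    (hli : LinearIndependent ℝ (Sum.elim
      (fun i : A => fderiv ℝ (fun z => G z p i.1) z)
      (fun j : Fin nH => fderiv ℝ (fun z => H z p j) z)))
    (hpos : ∀ d : Fin nz → ℝ, d ≠ 0 → (∀ i ∈ A, fderiv ℝ (fun z => G z p i) z d = 0) →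
      (∀ j, fderiv ℝ (fun z => H z p j) z d = 0) →
      0 < lagrangianHess J G H (p, (z, μ, lam)) d d) :
    Function.Injective
      (fderiv ℝ (kktMap J G H A) (p, (z, μ, lam)) ∘L ContinuousLinearMap.inr ℝ _ _) := by
  classical
  set D := fderiv ℝ (kktMap J G H A) (p, (z, μ, lam))
  have hdiff : HasFDerivAt (kktMap J G H A) D (p, (z, μ, lam)) :=
    ((contDiff_kktMap hJ hG hH A).differentiable one_ne_zero _).hasFDerivAt
  rw [injective_iff_map_eq_zero]
  rintro ⟨dz, dμ, dlam⟩ h0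
  have h0 : D (0, (dz, dμ, dlam)) = 0 := h0
  have hgrad := fderiv_lagrangianGrad_apply hJ hG hH p z dz μ dμ lam dlam
  have hfst : fderiv ℝ (lagrangianGrad J G H) (p, (z, μ, lam)) (0, (dz, dμ, dlam)) = 0 := by
    have h1 : HasFDerivAt (lagrangianGrad J G H) _ (p, (z, μ, lam)) := hdiff.fst
    rw [h1.fderiv]
    simp [h0]
  have hline : HasDerivAt (fun t : ℝ => (p, (z + t • dz, μ + t • dμ, lam + t • dlam)))
      (0, (dz, dμ, dlam)) 0 := by
    refine (hasDerivAt_const _ _).prodMk (.prodMk ?_ (.prodMk ?_ ?_))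
    · simpa using ((hasDerivAt_id (0 : ℝ)).smul_const dz).const_add z
    · simpa using ((hasDerivAt_id (0 : ℝ)).smul_const dμ).const_add μ
    · simpa using ((hasDerivAt_id (0 : ℝ)).smul_const dlam).const_add lam
  have hlz : HasDerivAt (fun t : ℝ => z + t • dz) dz 0 := hline.snd.fst
  have hk : HasDerivAt (fun t : ℝ => kktMap J G H A (p, (z + t • dz, μ + t • dμ, lam + t • dlam)))
      0 0 := by
    have := HasFDerivAt.comp_hasDerivAt (0 : ℝ) (l := kktMap J G H A) (l' := D)
      (by simpa using hdiff) hline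
    rwa [h0] at this
  have hpart : ∀ {f : (Fin nz → ℝ) → (Fin np → ℝ) → ℝ},
      (ContDiff ℝ 2 fun q : (Fin nz → ℝ) × (Fin np → ℝ) => f q.1 q.2) →
      HasDerivAt (fun t : ℝ => f (z + t • dz) p) (fderiv ℝ (fun z => f z p) z dz) 0 := fun {f} hf =>
    HasFDerivAt.comp_hasDerivAt (0 : ℝ) (l := fun z => f z p)
      (by simpa using (differentiable_curry_left hf p z).hasFDerivAt) hlz
  have hGA : ∀ i ∈ A, fderiv ℝ (fun z => G z p i) z dz = 0 := fun i hi => by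
    have h1 := hasDerivAt_pi.1 hk.snd.fst i
    simp only [kktMap, hi, if_true] at h1
    exact (hpart (f := fun z p => G z p i) (contDiff_pi.1 hG i)).unique h1
  have hGI : ∀ i ∉ A, dμ i = 0 := fun i hi => by
    have h1 := hasDerivAt_pi.1 hk.snd.fst i
    simp only [kktMap, hi, if_false] at h1
    exact (hasDerivAt_pi.1 hline.snd.snd.fst i).unique h1
  have hHz : ∀ j, fderiv ℝ (fun z => H z p j) z dz = 0 := fun j =>
    (hpart (f := fun z p => H z p j) (contDiff_pi.1 hH j)).unique
      (hasDerivAt_pi.1 hk.snd.snd j)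
  have hsum : lagrangianHess J G H (p, (z, μ, lam)) dz
      + (∑ i, dμ i • fderiv ℝ (fun w => G w p i) z
      + ∑ j, dlam j • fderiv ℝ (fun w => H w p j) z) = 0 := hgrad.symm.trans hfst
  have hdz : dz = 0 := by
    by_contra hne
    have h1 := DFunLike.congr_fun hsum dz
    have h2 : ∀ i, dμ i * fderiv ℝ (fun w => G w p i) z dz = 0 := fun i => by
      by_cases hi : i ∈ A
      · simp [hGA i hi]
      · simp [hGI i hi]
    simp only [_root_.add_apply, _root_.sum_apply, _root_.smul_apply, smul_eq_mul, h2, hHz,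
      mul_zero, Finset.sum_const_zero, add_zero, _root_.zero_apply] at h1
    exact (hpos dz hne hGA hHz).ne' h1
  subst hdz
  rw [map_zero, zero_add] at hsum
  have hA : ∑ i : A, dμ i • fderiv ℝ (fun w => G w p i) z
      = ∑ i, dμ i • fderiv ℝ (fun w => G w p i) z := by
    rw [← Finset.sum_filter_of_ne (p := (· ∈ A)) fun i _ hi => by
      by_contra hiA
      exact hi (by rw [hGI i hiA, zero_smul])]
    exact (Finset.sum_subtype (p := (· ∈ A)) (Finset.univ.filter (· ∈ A)) (by simp)
      fun i => dμ i • fderiv ℝ (fun w => G w p i) z).symm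
  have hlin := Fintype.linearIndependent_iff.1 hli
    (Sum.elim (fun i : A => dμ i) dlam) (by simpa [hA] using hsum)
  have hdμ : dμ = 0 := funext fun i => by
    by_cases hi : i ∈ A
    · exact hlin (Sum.inl ⟨i, hi⟩)
    · exact hGI i hi
  have hdlam : dlam = 0 := funext fun j => hlin (Sum.inr j)
  simp [hdμ, hdlam]

lemma isInvertible_of_injective_of_finrank_eq {E F : Type*} [NormedAddCommGroup E]
    [NormedSpace ℝ E] [FiniteDimensional ℝ E] [NormedAddCommGroup F] [NormedSpace ℝ F]
    [FiniteDimensional ℝ F] {f : E →L[ℝ] F} (hf : Function.Injective f)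
    (h : Module.finrank ℝ E = Module.finrank ℝ F) : f.IsInvertible :=
  ⟨(LinearEquiv.ofInjectiveOfFinrankEq (f : E →ₗ[ℝ] F) hf h).toContinuousLinearEquiv, by
    ext x
    exact DFunLike.congr_fun (LinearEquiv.coe_ofInjectiveOfFinrankEq _ hf h) x⟩

lemma finrank_kkt (nz nG nH : ℕ) :
    Module.finrank ℝ ((Fin nz → ℝ) × (Fin nG → ℝ) × (Fin nH → ℝ)) =
      Module.finrank ℝ (((Fin nz → ℝ) →L[ℝ] ℝ) × (Fin nG → ℝ) × (Fin nH → ℝ)) := by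
  rw [Module.finrank_prod, Module.finrank_prod (M := (Fin nz → ℝ) →L[ℝ] ℝ),
    ← (LinearMap.toContinuousLinearMap (𝕜 := ℝ) (E := Fin nz → ℝ) (F' := ℝ)).finrank_eq,
    Module.finrank_linearMap, Module.finrank_self, mul_one]

/-- The second-order condition persists under small perturbations. -/
lemma eventually_second_order
    (hJ : ContDiff ℝ 2 fun q : (Fin nz → ℝ) × (Fin np → ℝ) => J q.1 q.2)
    (hG : ContDiff ℝ 2 fun q : (Fin nz → ℝ) × (Fin np → ℝ) => G q.1 q.2)
    (hH : ContDiff ℝ 2 fun q : (Fin nz → ℝ) × (Fin np → ℝ) => H q.1 q.2) (A : Set (Fin nG))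
    (q₀ : (Fin np → ℝ) × ((Fin nz → ℝ) × (Fin nG → ℝ) × (Fin nH → ℝ)))
    (hpos : ∀ d : Fin nz → ℝ, d ≠ 0 →
      (∀ i ∈ A, fderiv ℝ (fun z => G z q₀.1 i) q₀.2.1 d = 0) →
      (∀ j, fderiv ℝ (fun z => H z q₀.1 j) q₀.2.1 d = 0) →
      0 < lagrangianHess J G H q₀ d d) :
    ∀ᶠ q in 𝓝 q₀, ∀ d : Fin nz → ℝ, d ≠ 0 →
      (∀ i ∈ A, fderiv ℝ (fun z => G z q.1 i) q.2.1 d = 0) →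
      (∀ j, fderiv ℝ (fun z => H z q.1 j) q.2.1 d = 0) →
      0 < lagrangianHess J G H q d d := by
  have hGc := fun i => continuous_fderiv_curry_left (nG := nG) (nH := nH)
    (f := fun z p => G z p i) (contDiff_pi.1 hG i)
  have hHc := fun j => continuous_fderiv_curry_left (nG := nG) (nH := nH)
    (f := fun z p => H z p j) (contDiff_pi.1 hH j)
  have hLc := continuous_lagrangianHess hJ hG hH
  have key : ∀ᶠ q in 𝓝 q₀, ∀ d ∈ Metric.sphere (0 : Fin nz → ℝ) 1,
      (∀ i ∈ A, fderiv ℝ (fun z => G z q.1 i) q.2.1 d = 0) →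
      (∀ j, fderiv ℝ (fun z => H z q.1 j) q.2.1 d = 0) →
      0 < lagrangianHess J G H q d d := by
    refine (isCompact_sphere (0 : Fin nz → ℝ) 1).eventually_forall_of_forall_eventually
      fun d hd => ?_
    have hd0 : d ≠ 0 := by
      rintro rfl
      simp at hd
    by_cases h1 : ∀ i ∈ A, fderiv ℝ (fun z => G z q₀.1 i) q₀.2.1 d = 0
    · by_cases h2 : ∀ j, fderiv ℝ (fun z => H z q₀.1 j) q₀.2.1 d = 0
      · have hc : Continuous fun r : ((Fin np → ℝ) × ((Fin nz → ℝ) × (Fin nG → ℝ) ×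
            (Fin nH → ℝ))) × (Fin nz → ℝ) => lagrangianHess J G H r.1 r.2 r.2 :=
          ((hLc.comp continuous_fst).clm_apply continuous_snd).clm_apply continuous_snd
        filter_upwards [(hc.tendsto (q₀, d)).eventually_const_lt (hpos d hd0 h1 h2)]
          with r hr _ _ using hr
      · push Not at h2
        obtain ⟨j, hj⟩ := h2
        have hc := ((hHc j).comp continuous_fst).clm_apply (continuous_snd (Y := Fin nz → ℝ))
        filter_upwards [(hc.tendsto (q₀, d)).eventually_ne hj] with r hr _ h
        exact absurd (h j) hr
    · push Not at h1
      obtain ⟨i, hi, hj⟩ := h1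
      have hc := ((hGc i).comp continuous_fst).clm_apply (continuous_snd (Y := Fin nz → ℝ))
      filter_upwards [(hc.tendsto (q₀, d)).eventually_ne hj] with r hr h _
      exact absurd (h i hi) hr
  filter_upwards [key] with q hq d hd hg hh
  have hn : 0 < ‖d‖ := norm_pos_iff.2 hd
  have := hq (‖d‖⁻¹ • d) (by simp [norm_smul, hn.ne']) (fun i hi => by simp [hg i hi])
    (fun j => by simp [hh j])
  simp only [map_smul, _root_.smul_apply, smul_eq_mul] at this
  exact pos_of_mul_pos_right (pos_of_mul_pos_right this (by positivity)) (by positivity)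

/-- LICQ persists under small perturbations. -/
lemma eventually_linearIndependent
    (hG : ContDiff ℝ 2 fun q : (Fin nz → ℝ) × (Fin np → ℝ) => G q.1 q.2)
    (hH : ContDiff ℝ 2 fun q : (Fin nz → ℝ) × (Fin np → ℝ) => H q.1 q.2) (A : Set (Fin nG))
    (q₀ : (Fin np → ℝ) × ((Fin nz → ℝ) × (Fin nG → ℝ) × (Fin nH → ℝ)))
    (hli : LinearIndependent ℝ (Sum.elim
      (fun i : A => fderiv ℝ (fun z => G z q₀.1 i.1) q₀.2.1)
      (fun j : Fin nH => fderiv ℝ (fun z => H z q₀.1 j) q₀.2.1))) :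
    ∀ᶠ q in 𝓝 q₀, LinearIndependent ℝ (Sum.elim
      (fun i : A => fderiv ℝ (fun z => G z q.1 i.1) q.2.1)
      (fun j : Fin nH => fderiv ℝ (fun z => H z q.1 j) q.2.1)) := by
  have hc : Continuous fun q : (Fin np → ℝ) × ((Fin nz → ℝ) × (Fin nG → ℝ) × (Fin nH → ℝ)) =>
      (Sum.elim (fun i : A => fderiv ℝ (fun z => G z q.1 i.1) q.2.1)
      (fun j : Fin nH => fderiv ℝ (fun z => H z q.1 j) q.2.1)) := by
    refine continuous_pi ?_
    rintro (i | j)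
    · exact continuous_fderiv_curry_left (f := fun z p => G z p i) (contDiff_pi.1 hG i)
    · exact continuous_fderiv_curry_left (f := fun z p => H z p j) (contDiff_pi.1 hH j)
  exact (hc.tendsto q₀).eventually hli.eventually

/-- A zero of the KKT system with `A` active satisfying the sign conditions, LICQ and the
second-order condition is strongly regular. -/
lemma stronglyRegular_of_kktMap_eq_zero
    (hJ : ContDiff ℝ 2 fun q : (Fin nz → ℝ) × (Fin np → ℝ) => J q.1 q.2)
    (hG : ContDiff ℝ 2 fun q : (Fin nz → ℝ) × (Fin np → ℝ) => G q.1 q.2)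
    (hH : ContDiff ℝ 2 fun q : (Fin nz → ℝ) × (Fin np → ℝ) => H q.1 q.2) {A : Set (Fin nG)}
    {p : Fin np → ℝ} {z : Fin nz → ℝ} {μ : Fin nG → ℝ} {lam : Fin nH → ℝ}
    (hact : {i | G z p i = 0} = A)
    (hzero : kktMap J G H A (p, (z, μ, lam)) = 0)
    (hμ : ∀ i ∈ A, 0 < μ i) (hGneg : ∀ i ∉ A, G z p i < 0)
    (hli : LinearIndependent ℝ (Sum.elim
      (fun i : A => fderiv ℝ (fun z => G z p i.1) z)
      (fun j : Fin nH => fderiv ℝ (fun z => H z p j) z)))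
    (hpos : ∀ d : Fin nz → ℝ, d ≠ 0 → (∀ i ∈ A, fderiv ℝ (fun z => G z p i) z d = 0) →
      (∀ j, fderiv ℝ (fun z => H z p j) z d = 0) →
      0 < lagrangianHess J G H (p, (z, μ, lam)) d d) :
    StronglyRegular J G H p z μ lam := by
  subst hact
  simp only [Set.mem_ofPred_eq] at hμ hGneg hpos
  simp only [kktMap, Prod.mk_eq_zero, funext_iff, Set.mem_ofPred_eq, Pi.zero_apply] at hzero
  obtain ⟨hgrad, hcompl, hHz⟩ := hzero
  have hGle : ∀ i, G z p i ≤ 0 := fun i => by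
    by_cases h : G z p i = 0
    · exact h.le
    · exact (hGneg i h).le
  have hμ0 : ∀ i, G z p i ≠ 0 → μ i = 0 := fun i h => by simpa [h] using hcompl i
  refine ⟨⟨hHz, hGle⟩, ?_, hli, ⟨hgrad, fun i => ?_, Finset.sum_eq_zero fun i _ => ?_⟩,
    fun i => ?_, hpos⟩
  · exact isLocalMinOn_of_second_order (f := fun z => J z p) (g := fun i z => G z p i)
      (h := fun j z => H z p j) (differentiable_curry_left hJ p)
      (fun i => differentiable_curry_left (f := fun z p => G z p i) (contDiff_pi.1 hG i) p)
      (fun j => differentiable_curry_left (f := fun z p => H z p j) (contDiff_pi.1 hH j) p)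
      (fun i h => hμ0 i h.ne) hGle hHz hμ (hasFDerivAt_fderiv_lagrangian hJ hG hH p z μ lam)
      hgrad hpos
  all_goals by_cases h : G z p i = 0
  · exact (hμ i h).le
  · exact (hμ0 i h).ge
  · simp [h]
  · simp [hμ0 i h]
  · simpa [h] using hμ i h
  · simpa [hμ0 i h] using hGneg i h

/-- A strongly regular triple satisfying the sign conditions for `A` solves the KKT system with
`A` active. -/
lemma StronglyRegular.kktMap_eq_zero {A : Set (Fin nG)}
    {p : Fin np → ℝ} {z : Fin nz → ℝ} {μ : Fin nG → ℝ} {lam : Fin nH → ℝ}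
    (h : StronglyRegular J G H p z μ lam) (hμ : ∀ i ∈ A, 0 < μ i)
    (hGneg : ∀ i ∉ A, G z p i < 0) : kktMap J G H A (p, (z, μ, lam)) = 0 := by
  obtain ⟨⟨hHz, hGle⟩, -, -, ⟨hgrad, hμ0, hsum⟩, -, -⟩ := h
  have hc : ∀ i, μ i * G z p i = 0 := fun i =>
    (Finset.sum_eq_zero_iff_of_nonpos fun i _ =>
      mul_nonpos_of_nonneg_of_nonpos (hμ0 i) (hGle i)).1 hsum i (Finset.mem_univ i)
  refine Prod.ext hgrad (Prod.ext (funext fun i => ?_) (funext hHz))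
  by_cases hi : i ∈ A
  · simpa [kktMap, hi] using (mul_eq_zero.1 (hc i)).resolve_left (hμ i hi).ne'
  · simpa [kktMap, hi] using (mul_eq_zero.1 (hc i)).resolve_right (hGneg i hi).ne

end KKT

/-- Sensitivity theorem (existence part): if `zhat` is a strongly regular local minimum of
NLP(phat) with multipliers `muhat, λ̂` and the data are twice continuously differentiable, then
for all parameters `p` in a ball around `phat` the perturbed problem NLP(p) has a strongly
regular local minimum `z*(p)` with multipliers `μ*(p), λ*(p)`, unique in a ball around
`(zhat, muhat, λ̂)`, which coincides with `(zhat, muhat, λ̂)` at `p = phat`, and the active set is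
invariant: `A(z*(p), p) = A(zhat, phat)`. -/
theorem sensitivity_existence_and_active_set_invariance
    {nz np nG nH : ℕ}
    (J : (Fin nz → ℝ) → (Fin np → ℝ) → ℝ)
    (G : (Fin nz → ℝ) → (Fin np → ℝ) → Fin nG → ℝ)
    (H : (Fin nz → ℝ) → (Fin np → ℝ) → Fin nH → ℝ)
    (hJ : ContDiff ℝ 2 fun q : (Fin nz → ℝ) × (Fin np → ℝ) => J q.1 q.2)
    (hG : ContDiff ℝ 2 fun q : (Fin nz → ℝ) × (Fin np → ℝ) => G q.1 q.2)
    (hH : ContDiff ℝ 2 fun q : (Fin nz → ℝ) × (Fin np → ℝ) => H q.1 q.2)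
    (phat : Fin np → ℝ) (zhat : Fin nz → ℝ) (muhat : Fin nG → ℝ) (lamhat : Fin nH → ℝ)
    (hreg : StronglyRegular J G H phat zhat muhat lamhat) :
    ∃ ε > (0 : ℝ), ∃ δ > (0 : ℝ),
      ∃ (zs : (Fin np → ℝ) → Fin nz → ℝ)
        (μs : (Fin np → ℝ) → Fin nG → ℝ)
        (lams : (Fin np → ℝ) → Fin nH → ℝ),
        -- at the nominal parameter the solution is the nominal one
        zs phat = zhat ∧ μs phat = muhat ∧ lams phat = lamhat ∧
        ∀ p ∈ ball phat ε,
          -- the triple lies in the δ-ball around (zhat, muhat, λ̂)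
          (zs p, μs p, lams p) ∈ ball (zhat, muhat, lamhat) δ ∧
          -- it is a strongly regular local minimum of NLP(p) with its multipliers
          StronglyRegular J G H p (zs p) (μs p) (lams p) ∧
          -- uniqueness in the δ-ball
          (∀ (z : Fin nz → ℝ) (μ : Fin nG → ℝ) (lam : Fin nH → ℝ),
            (z, μ, lam) ∈ ball (zhat, muhat, lamhat) δ →
            StronglyRegular J G H p z μ lam →
            (z, μ, lam) = (zs p, μs p, lams p)) ∧
          -- active set invariance
          {i | G (zs p) p i = 0} = {i | G zhat phat i = 0} := by
  set A : Set (Fin nG) := {i | G zhat phat i = 0}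
  set q₀ : (Fin np → ℝ) × ((Fin nz → ℝ) × (Fin nG → ℝ) × (Fin nH → ℝ)) :=
    (phat, (zhat, muhat, lamhat)) with hq₀
  have hreg' := hreg
  obtain ⟨⟨hHz, hGle⟩, -, hli, -, hsc, hpos⟩ := hreg'
  have hμA : ∀ i ∈ A, 0 < muhat i := fun i hi => by
    have h := hsc i
    rwa [show G zhat phat i = 0 from hi, sub_zero] at h
  have hGA : ∀ i ∉ A, G zhat phat i < 0 := fun i hi => lt_of_le_of_ne (hGle i) hi
  have hzero : kktMap J G H A q₀ = 0 := hreg.kktMap_eq_zero hμA hGA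
  have hstrict := (contDiff_kktMap hJ hG hH A).contDiffAt.hasStrictFDerivAt
    (x := q₀) one_ne_zero
  have hinv := isInvertible_of_injective_of_finrank_eq
    (injective_fderiv_kktMap hJ hG hH A hli hpos) (finrank_kkt nz nG nH)
  set ψ := hstrict.implicitFunctionOfProdDomain hinv
  have hψt : Tendsto ψ (𝓝 phat) (𝓝 (zhat, muhat, lamhat)) :=
    hstrict.tendsto_implicitFunctionOfProdDomain hinv
  have hψz : ∀ᶠ p in 𝓝 phat, kktMap J G H A (p, ψ p) = 0 := by
    simpa only [hzero] using hstrict.eventually_apply_implicitFunctionOfProdDomain hinv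
  have hψiff : ∀ᶠ q in 𝓝 q₀, kktMap J G H A q = 0 ↔ ψ q.1 = q.2 := by
    simpa only [hzero] using hstrict.eventually_apply_eq_iff_implicitFunctionOfProdDomain hinv
  have hsignμ : ∀ᶠ q in 𝓝 q₀, ∀ i ∈ A, 0 < q.2.2.1 i := by
    refine (Filter.eventually_all_finite A.toFinite).2 fun i hi => ?_
    have hc : Continuous fun q : (Fin np → ℝ) × ((Fin nz → ℝ) × (Fin nG → ℝ) × (Fin nH → ℝ)) =>
      q.2.2.1 i := by fun_prop
    exact (hc.tendsto q₀).eventually_const_lt (hμA i hi)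
  have hsignG : ∀ᶠ q in 𝓝 q₀, ∀ i ∉ A, G q.2.1 q.1 i < 0 := by
    refine (Filter.eventually_all_finite Aᶜ.toFinite).2 fun i hi => ?_
    have hc : Continuous fun q : (Fin np → ℝ) × ((Fin nz → ℝ) × (Fin nG → ℝ) × (Fin nH → ℝ)) =>
        G q.2.1 q.1 i :=
      (contDiff_pi.1 hG i).continuous.comp
        (f := fun q : (Fin np → ℝ) × ((Fin nz → ℝ) × (Fin nG → ℝ) × (Fin nH → ℝ)) =>
          (q.2.1, q.1)) (by fun_prop)
    exact (hc.tendsto q₀).eventually_lt_const (hGA i hi)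
  have hunique : ∀ᶠ q in 𝓝 q₀, StronglyRegular J G H q.1 q.2.1 q.2.2.1 q.2.2.2 →
      q.2 = ψ q.1 := by
    filter_upwards [hψiff, hsignμ, hsignG] with q hq hμ hg hr
    exact (hq.1 (hr.kktMap_eq_zero hμ hg)).symm
  rw [hq₀, nhds_prod_eq, (nhds_basis_ball.prod nhds_basis_ball).eventually_iff] at hunique
  obtain ⟨⟨ε₁, δ⟩, ⟨hε₁, hδ⟩, hunique⟩ := hunique
  have hgraph : Tendsto (fun p => (p, ψ p)) (𝓝 phat) (𝓝 q₀) := tendsto_id.prodMk_nhds hψt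
  have hgood : ∀ᶠ p in 𝓝 phat, ψ p ∈ ball (zhat, muhat, lamhat) δ ∧
      StronglyRegular J G H p (ψ p).1 (ψ p).2.1 (ψ p).2.2 ∧ {i | G (ψ p).1 p i = 0} = A := by
    filter_upwards [hψt.eventually (ball_mem_nhds _ hδ), hψz, hgraph.eventually hsignμ,
      hgraph.eventually hsignG,
      hgraph.eventually (eventually_linearIndependent hG hH A q₀ hli),
      hgraph.eventually (eventually_second_order hJ hG hH A q₀ hpos)] with p h1 h2 h3 h4 h5 h6
    have hact : {i | G (ψ p).1 p i = 0} = A := by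
      ext i
      refine ⟨fun hi => by_contra fun hiA => (h4 i hiA).ne hi, fun hi => ?_⟩
      have := congrFun (congrArg (fun y => y.2.1) h2) i
      simpa [kktMap, hi] using this
    exact ⟨h1, stronglyRegular_of_kktMap_eq_zero hJ hG hH hact h2 h3 h4 h5 h6, hact⟩
  obtain ⟨ε₂, hε₂, hgood⟩ := Metric.eventually_nhds_iff_ball.1 hgood
  have hhat : ψ phat = (zhat, muhat, lamhat) := (hψiff.self_of_nhds.1 hzero)
  refine ⟨min ε₁ ε₂, lt_min hε₁ hε₂, δ, hδ, fun p => (ψ p).1, fun p => (ψ p).2.1,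
    fun p => (ψ p).2.2, by simp [hhat], by simp [hhat], by simp [hhat], fun p hp => ?_⟩
  obtain ⟨h1, h2, h3⟩ := hgood p (ball_subset_ball (min_le_right _ _) hp)
  exact ⟨h1, h2, fun z μ lam hx hr =>
    hunique (x := (p, (z, μ, lam))) ⟨ball_subset_ball (min_le_left _ _) hp, hx⟩ hr, h3⟩
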